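/- Suppose J has mean ∫ z dJ(z) = 1 and is absolutely continuous with a density bounded away from 0 on every compact subset of [0,∞). If f¹ and f² are mean-field models with the same initial condition, f¹_x(0) = f²_x(0) for all x ∈ ℝ, then f¹_x(t) = f²_x(t) for all x ∈ ℝ and all t ≥ 0. (No assumption is made that the initial CDF has a finite mean.) -/

import Mathlib

open MeasureTheory Filter Set ENNReal NNReal

noncomputable section

/-- sign: `1` if `0 ≤ y`, `-1` otherwise. -/
def sgn (y : ℝ) : ℝ := if 0 ≤ y then 1 else -1

/-- `F` is a (proper) cumulative distribution function. -/
structure IsCDF (F : ℝ → ℝ) : Prop where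
  mono : Monotone F
  right_continuous : ∀ x, ContinuousWithinAt F (Set.Ici x) x
  tendsto_atBot : Filter.Tendsto F Filter.atBot (nhds 0)
  tendsto_atTop : Filter.Tendsto F Filter.atTop (nhds 1)

open Classical in
/-- The Lebesgue–Stieltjes measure associated with `F` (junk value `0` if `F` is not
monotone right-continuous). -/
noncomputable def cdfMeasure (F : ℝ → ℝ) : Measure ℝ :=
  if h : Monotone F ∧ ∀ x, ContinuousWithinAt F (Set.Ici x) x then
    StieltjesFunction.measure ⟨F, h.1, h.2⟩
  else 0

/-- Quantile (generalized inverse) of `F`. -/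
noncomputable def quantile (F : ℝ → ℝ) (ν : ℝ) : ℝ := sInf {y | ν ≤ F y}

/-- Complementary CDF of the jump-size distribution `J`. -/
noncomputable def Jbar (J : Measure ℝ) (u : ℝ) : ℝ := (J (Set.Ioi u)).toReal

/-- Right-hand side of the mean-field-model equation (with the minus sign). -/
noncomputable def mfmRHS (η : ℝ → ℝ) (J : Measure ℝ) (F : ℝ → ℝ) (x : ℝ) : ℝ :=
  -∫ ν in Set.Ioo (0:ℝ) 1,
      η ν * (if quantile F ν ≤ x then Jbar J (x - quantile F ν) else 0)

/-- Mean-field model: (a) each `f ⬝ t` is a CDF; (b) `t ↦ f x t` is nonincreasing and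
Lipschitz with constant independent of `x`; (c) wherever the `t`-derivative exists it
equals the mean-field right-hand side. -/
def IsMFM (η : ℝ → ℝ) (J : Measure ℝ) (f : ℝ → ℝ → ℝ) : Prop :=
  (∀ t : ℝ, 0 ≤ t → IsCDF (fun x => f x t)) ∧
  (∀ x : ℝ, AntitoneOn (f x) (Set.Ici 0)) ∧
  (∃ c : NNReal, ∀ x : ℝ, LipschitzOnWith c (f x) (Set.Ici 0)) ∧
  (∀ x t : ℝ, 0 ≤ t → ∀ d : ℝ,
    HasDerivWithinAt (f x) d (Set.Ici 0) t → d = mfmRHS η J (fun y => f y t) x)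

/-- The nondecreasing rearrangement of a finite tuple. -/
noncomputable def sortVec {n : ℕ} (w : Fin n → ℝ) : Fin n → ℝ := fun i => w (Tuple.sort w i)

/-- Outcome of one jump urge: `p = (ℓ, u, z)`; if `u ≤ η_n ℓ` the rank-`ℓ` particle jumps by
`z`, everything is recentered by `z/n` and sorted; otherwise nothing happens. -/
noncomputable def jumpOutcome (n : ℕ) (ηn : Fin n → ℝ) (w : Fin n → ℝ)
    (p : Fin n × ℝ × ℝ) : Fin n → ℝ :=
  if p.2.1 ≤ ηn p.1 then
    sortVec (fun i => w i + (if i = p.1 then p.2.2 else 0) - p.2.2 / n)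
  else w

/-- The Markov transition kernel of the embedded (centered) jump chain: `ℓ` uniform on
`Fin n`, `u` uniform on `[0,1]`, `z ∼ J`, independent. -/
noncomputable def Kn (n : ℕ) (ηn : Fin n → ℝ) (J : Measure ℝ) (w : Fin n → ℝ) :
    Measure (Fin n → ℝ) :=
  Measure.map (jumpOutcome n ηn w)
    ((((n : ℝ≥0∞))⁻¹ • (Measure.count : Measure (Fin n))).prod
      ((MeasureTheory.volume.restrict (Set.Icc (0:ℝ) 1)).prod J))

/-- The state space: nondecreasing, centered configurations. -/
def Wset (n : ℕ) : Set (Fin n → ℝ) := {w | Monotone w ∧ ∑ i, w i = 0}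

/-- `p`-th absolute empirical moment. -/
noncomputable def Phi (n : ℕ) (p : ℝ) (w : Fin n → ℝ) : ℝ :=
  (1 / n) * ∑ i, |w i| ^ p

/-- The drift functional `G_n`. -/
noncomputable def Gn (n : ℕ) (χ : ℝ) (ηn : Fin n → ℝ) (w : Fin n → ℝ) : ℝ :=
  (2 + χ) * ((1 / n) * ∑ i, (ηn i - (1 / n) * ∑ ℓ, ηn ℓ) * sgn (w i) * |w i| ^ (1 + χ))

/-- Empirical CDF of the configuration `w`. -/
noncomputable def empCDF (n : ℕ) (w : Fin n → ℝ) (x : ℝ) : ℝ :=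
  (1 / n) * (Finset.univ.filter (fun i => w i ≤ x)).card

/-- `J` is absolutely continuous with a density bounded away from `0` on every compact
subset of `[0, ∞)`. -/
def DensityLowerBdd (J : Measure ℝ) : Prop :=
  ∃ g : ℝ → ℝ≥0∞, J = MeasureTheory.volume.withDensity g ∧
    ∀ b : ℝ, 0 < b → ∃ c : ℝ≥0∞, 0 < c ∧ ∀ x ∈ Set.Icc (0:ℝ) b, c ≤ g x

/-- The test-function class `C_b`: bounded continuous functions that are constant near
`-∞` and near `+∞`. -/
def CbTail (h : ℝ → ℝ) : Prop :=
  Continuous h ∧ (∃ M : ℝ, ∀ x, |h x| ≤ M) ∧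
    ∃ a b : ℝ, a ≤ b ∧ (∀ x ≤ a, h x = h a) ∧ (∀ x, b ≤ x → h x = h b)

/-- The generator-type operator `L[F]h`. -/
noncomputable def Lop (η : ℝ → ℝ) (J : Measure ℝ) (F : ℝ → ℝ) (h : ℝ → ℝ) : ℝ :=
  ∫ ν in Set.Ioo (0:ℝ) 1, η ν * ∫ z, (h (quantile F ν + z) - h (quantile F ν)) ∂J

end
section MeanField
open MeasureTheory Filter Set ENNReal NNReal

/-- For a CDF `F`, the quantile function is the lower adjoint of `F` on `(0, 1)`. -/
lemma IsCDF.quantile_le_iff {F : ℝ → ℝ} (hF : IsCDF F) {ν : ℝ} (hν : ν ∈ Ioo (0 : ℝ) 1)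
    (y : ℝ) : quantile F ν ≤ y ↔ ν ≤ F y := by
  have hne : {y | ν ≤ F y}.Nonempty :=
    ((hF.tendsto_atTop.eventually (lt_mem_nhds hν.2)).exists).imp fun _ h => le_of_lt h
  obtain ⟨a, ha⟩ := (hF.tendsto_atBot.eventually (gt_mem_nhds hν.1)).exists
  have hbdd : BddBelow {y | ν ≤ F y} :=
    ⟨a, fun b hb => le_of_not_gt fun hba => absurd (hF.mono hba.le) (not_le.2 (ha.trans_le hb))⟩
  refine ⟨fun h => ?_, fun h => csInf_le hbdd h⟩
  have hgt : ∀ z ∈ Ioi y, ν ≤ F z := fun z hz => by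
    obtain ⟨w, hw, hwz⟩ := exists_lt_of_csInf_lt hne (lt_of_le_of_lt h hz)
    exact le_trans hw (hF.mono hwz.le)
  exact ge_of_tendsto ((hF.right_continuous y).mono Ioi_subset_Ici_self)
    (eventually_mem_nhdsWithin.mono hgt)

lemma IsCDF.mem_Icc {F : ℝ → ℝ} (hF : IsCDF F) (x : ℝ) : F x ∈ Icc (0 : ℝ) 1 :=
  ⟨hF.mono.le_of_tendsto hF.tendsto_atBot x, hF.mono.ge_of_tendsto hF.tendsto_atTop x⟩

/-- The cumulative jump rate `u ↦ ∫₀ᵘ η`, extended to be constant outside `[0, 1]`. -/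
noncomputable def cumRate (η : ℝ → ℝ) (u : ℝ) : ℝ :=
  ∫ ν in Ioo (0 : ℝ) 1, η ν * (if ν ≤ u then 1 else 0)

lemma integrable_mul_step {η : ℝ → ℝ} (hη : AEStronglyMeasurable η (volume.restrict (Ioo 0 1)))
    (hb : ∀ ν ∈ Ioo (0 : ℝ) 1, |η ν| ≤ 1) (u : ℝ) :
    Integrable (fun ν => η ν * (if ν ≤ u then (1 : ℝ) else 0)) (volume.restrict (Ioo 0 1)) := by
  refine Integrable.of_bound (hη.mul ?_) 1 ?_
  · exact (Measurable.ite measurableSet_Iic measurable_const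
      measurable_const).aestronglyMeasurable
  · filter_upwards [ae_restrict_mem measurableSet_Ioo] with ν hν
    split_ifs <;> simp [hb ν hν]

lemma abs_cumRate_sub_le {η : ℝ → ℝ}
    (hη : AEStronglyMeasurable η (volume.restrict (Ioo 0 1)))
    (hb : ∀ ν ∈ Ioo (0 : ℝ) 1, |η ν| ≤ 1) (u w : ℝ) :
    |cumRate η u - cumRate η w| ≤ |u - w| := by
  wlog h : w ≤ u generalizing u w
  · rw [abs_sub_comm, abs_sub_comm u]
    exact this w u (le_of_not_ge h)
  rw [cumRate, cumRate, ← integral_sub (integrable_mul_step hη hb u) (integrable_mul_step hη hb w),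
    ← Real.norm_eq_abs]
  have hint : Integrable ((Ioc w u).indicator fun _ => (1 : ℝ)) volume :=
    (integrable_indicator_iff measurableSet_Ioc).2 (integrableOn_const (by simp))
  calc _ ≤ ∫ ν in Ioo (0 : ℝ) 1, (Ioc w u).indicator (fun _ => (1 : ℝ)) ν := by
        refine norm_integral_le_of_norm_le hint.restrict ?_
        filter_upwards [ae_restrict_mem measurableSet_Ioo] with ν hν
        by_cases h1 : ν ≤ w
        · simp [h1, h1.trans h, indicator, not_lt.2 h1]
        · by_cases h2 : ν ≤ u
          · simpa [h1, h2, indicator, not_le.1 h1] using hb ν hν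
          · simp [h1, h2]
    _ ≤ ∫ ν, (Ioc w u).indicator (fun _ => (1 : ℝ)) ν :=
        setIntegral_le_integral hint (ae_of_all _ fun ν => indicator_nonneg (by simp) ν)
    _ = |u - w| := by
        rw [integral_indicator measurableSet_Ioc]
        simp [h, abs_of_nonneg]

lemma abs_cumRate_le {η : ℝ → ℝ} (hb : ∀ ν ∈ Ioo (0 : ℝ) 1, |η ν| ≤ 1) (u : ℝ) :
    |cumRate η u| ≤ 1 := by
  have h := norm_setIntegral_le_of_norm_le_const (μ := volume) (s := Ioo (0 : ℝ) 1) (C := 1)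
    (f := fun ν => η ν * (if ν ≤ u then (1 : ℝ) else 0)) (by simp)
    (fun ν hν => by split_ifs <;> simp [hb ν hν])
  simpa [cumRate] using h

lemma IsCDF.ite_quantile_eq_integral {J : Measure ℝ} (hJ0 : J (Iic 0) = 0) {F : ℝ → ℝ} (hF : IsCDF F)
    (x : ℝ) {ν : ℝ} (hν : ν ∈ Ioo (0 : ℝ) 1) :
    (if quantile F ν ≤ x then Jbar J (x - quantile F ν) else 0) =
      ∫ z, ((if ν ≤ F x then (1 : ℝ) else 0) - (if ν ≤ F (x - z) then 1 else 0)) ∂J := by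
  have hpos : ∀ᵐ z ∂J, 0 < z := by
    rw [ae_iff]; simpa [not_lt, Iic] using hJ0
  simp_rw [← hF.quantile_le_iff hν]
  split_ifs with h
  · have : ∀ z, (1 : ℝ) - (if quantile F ν ≤ x - z then 1 else 0) =
        (Ioi (x - quantile F ν)).indicator 1 z := fun z => by
      by_cases hz : quantile F ν ≤ x - z
      · rw [indicator_of_notMem (by simp; linarith)]; simp [hz]
      · rw [indicator_of_mem (by simp; linarith)]; simp [hz]
    simp_rw [this]
    rw [integral_indicator_one measurableSet_Ioi]
    rfl
  · symm
    refine integral_eq_zero_of_ae ?_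
    filter_upwards [hpos] with z hz
    simp [show ¬ quantile F ν ≤ x - z by linarith]

variable {η : ℝ → ℝ} {J : Measure ℝ} [IsProbabilityMeasure J]

lemma integrable_cumRate_comp (hη : AEStronglyMeasurable η (volume.restrict (Ioo 0 1)))
    (hb : ∀ ν ∈ Ioo (0 : ℝ) 1, |η ν| ≤ 1) {F : ℝ → ℝ} (hF : IsCDF F) (x : ℝ) :
    Integrable (fun z => cumRate η (F (x - z))) J := by
  have hc : Continuous (cumRate η) :=
    (LipschitzWith.of_dist_le_mul (K := 1) fun u w => by
      simpa [Real.dist_eq] using abs_cumRate_sub_le hη hb u w).continuous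
  exact Integrable.of_bound
    (hc.measurable.comp (hF.mono.measurable.comp (by fun_prop))).aestronglyMeasurable 1
    (ae_of_all _ fun z => abs_cumRate_le hb _)

/-- The mean-field right-hand side in terms of the cumulative jump rate. -/
lemma IsCDF.mfmRHS_eq (hη : AEStronglyMeasurable η (volume.restrict (Ioo 0 1)))
    (hb : ∀ ν ∈ Ioo (0 : ℝ) 1, |η ν| ≤ 1) (hJ0 : J (Iic 0) = 0) {F : ℝ → ℝ} (hF : IsCDF F)
    (x : ℝ) : mfmRHS η J F x = ∫ z, cumRate η (F (x - z)) ∂J - cumRate η (F x) := by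
  have hmeas : MeasurableSet {p : ℝ × ℝ | p.1 ≤ F (x - p.2)} :=
    measurableSet_le measurable_fst (hF.mono.measurable.comp (by fun_prop))
  have hmeas' : MeasurableSet {p : ℝ × ℝ | p.1 ≤ F x} :=
    measurableSet_le measurable_fst measurable_const
  have hint : Integrable (Function.uncurry fun ν z => η ν *
      ((if ν ≤ F x then (1 : ℝ) else 0) - (if ν ≤ F (x - z) then 1 else 0)))
      ((volume.restrict (Ioo (0 : ℝ) 1)).prod J) := by
    refine Integrable.of_bound (hη.comp_fst.mul ?_) 1 ?_
    · exact ((Measurable.ite hmeas' measurable_const measurable_const).sub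
        (Measurable.ite hmeas measurable_const measurable_const)).aestronglyMeasurable
    · have : ∀ᵐ p ∂((volume.restrict (Ioo (0 : ℝ) 1)).prod J), p.1 ∈ Ioo (0 : ℝ) 1 :=
        Measure.quasiMeasurePreserving_fst.ae (ae_restrict_mem measurableSet_Ioo)
      filter_upwards [this] with p hp
      have := hb p.1 hp
      simp only [Function.uncurry]
      split_ifs <;> simp [this]
  rw [mfmRHS, setIntegral_congr_fun measurableSet_Ioo
    (fun ν hν => by
      simp only [hF.ite_quantile_eq_integral hJ0 x hν, ← integral_const_mul]; rfl),
    integral_integral_swap hint]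
  have : ∀ z, ∫ ν in Ioo (0 : ℝ) 1, η ν *
      ((if ν ≤ F x then (1 : ℝ) else 0) - (if ν ≤ F (x - z) then 1 else 0)) =
      cumRate η (F x) - cumRate η (F (x - z)) := fun z => by
    simp_rw [mul_sub]
    exact integral_sub (integrable_mul_step hη hb _) (integrable_mul_step hη hb _)
  simp_rw [this]
  rw [integral_sub (integrable_const _) (integrable_cumRate_comp hη hb hF x)]
  simp

/-- The mean-field right-hand side is Lipschitz in the CDF for the uniform distance. -/
lemma abs_mfmRHS_sub_le (hη : AEStronglyMeasurable η (volume.restrict (Ioo 0 1)))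
    (hb : ∀ ν ∈ Ioo (0 : ℝ) 1, |η ν| ≤ 1) (hJ0 : J (Iic 0) = 0) {F G : ℝ → ℝ} (hF : IsCDF F)
    (hG : IsCDF G) {M : ℝ} (hM : ∀ y, |F y - G y| ≤ M) (x : ℝ) :
    |mfmRHS η J F x - mfmRHS η J G x| ≤ 2 * M := by
  have hle : ∀ y, |cumRate η (F y) - cumRate η (G y)| ≤ M := fun y =>
    (abs_cumRate_sub_le hη hb _ _).trans (hM y)
  have h1 : |∫ z, (cumRate η (F (x - z)) - cumRate η (G (x - z))) ∂J| ≤ M := by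
    simpa using norm_integral_le_of_norm_le_const (μ := J) (C := M)
      (f := fun z => cumRate η (F (x - z)) - cumRate η (G (x - z)))
      (ae_of_all _ fun z => hle (x - z))
  rw [integral_sub (integrable_cumRate_comp hη hb hF x)
    (integrable_cumRate_comp hη hb hG x)] at h1
  rw [hF.mfmRHS_eq hη hb hJ0, hG.mfmRHS_eq hη hb hJ0]
  have h2 := hle x
  rw [abs_le] at *
  constructor <;> linarith

/-- One Picard step: an exponential bound on the distance of two mean-field models with the same
initial condition improves by a factor of two. -/
lemma IsMFM.abs_sub_le_half (hη : AEStronglyMeasurable η (volume.restrict (Ioo 0 1)))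
    (hb : ∀ ν ∈ Ioo (0 : ℝ) 1, |η ν| ≤ 1) (hJ0 : J (Iic 0) = 0) {f g : ℝ → ℝ → ℝ}
    (hf : IsMFM η J f) (hg : IsMFM η J g) (h0 : ∀ x, f x 0 = g x 0) {B : ℝ} (hB : 0 ≤ B)
    (h : ∀ x t, 0 ≤ t → |f x t - g x t| ≤ B * Real.exp (4 * t)) (x t : ℝ) (ht : 0 ≤ t) :
    |f x t - g x t| ≤ B / 2 * Real.exp (4 * t) := by
  obtain ⟨hfc, -, ⟨c, hfl⟩, hfd⟩ := hf
  obtain ⟨hgc, -, ⟨c', hgl⟩, hgd⟩ := hg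
  have hsub : uIcc 0 t ⊆ Ici 0 := by rw [uIcc_of_le ht]; exact Icc_subset_Ici_self
  have hac : AbsolutelyContinuousOnInterval (fun s => f x s - g x s) 0 t :=
    ((hfl x).mono hsub).absolutelyContinuousOnInterval.sub
      ((hgl x).mono hsub).absolutelyContinuousOnInterval
  have hderiv : ∀ᵐ s, s ∈ Ioc 0 t →
      ‖deriv (fun s => f x s - g x s) s‖ ≤ 2 * (B * Real.exp (4 * s)) := by
    filter_upwards [(hfl x).ae_differentiableWithinAt_of_mem_real,
      (hgl x).ae_differentiableWithinAt_of_mem_real] with s h1 h2 hs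
    have hn : Ici (0 : ℝ) ∈ nhds s := Ici_mem_nhds hs.1
    have d1 := ((h1 hs.1.le).differentiableAt hn).hasDerivAt
    have d2 := ((h2 hs.1.le).differentiableAt hn).hasDerivAt
    rw [(d1.fun_sub d2).deriv, hfd x s hs.1.le _ d1.hasDerivWithinAt,
      hgd x s hs.1.le _ d2.hasDerivWithinAt]
    exact abs_mfmRHS_sub_le hη hb hJ0 (hfc s hs.1.le) (hgc s hs.1.le)
      (fun y => h y s hs.1.le) x
  have hprim : ∫ s in (0 : ℝ)..t, 2 * (B * Real.exp (4 * s)) =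
      B / 2 * Real.exp (4 * t) - B / 2 := by
    rw [intervalIntegral.integral_eq_sub_of_hasDerivAt
      (f := fun s => B / 2 * Real.exp (4 * s))]
    · simp
    · intro s _
      have := (((hasDerivAt_id s).const_mul 4).exp).const_mul (B / 2)
      convert! this using 1
      simp only [id]; ring
    · exact Continuous.intervalIntegrable (by fun_prop) _ _
  have key := intervalIntegral.norm_integral_le_of_norm_le ht hderiv
    (Continuous.intervalIntegrable (by fun_prop) _ _)
  rw [hac.integral_deriv_eq_sub, hprim, h0, sub_self, sub_zero, Real.norm_eq_abs] at key
  linarith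

end MeanField

section Theorems
open MeasureTheory Filter Set ENNReal NNReal

theorem mean_field_model_unique
    (η : ℝ → ℝ)
    (hη_cont : ContinuousOn η (Set.Icc 0 1))
    (hη_anti : StrictAntiOn η (Set.Icc 0 1))
    (hη0 : η 0 = 1) (hη1 : η 1 = 0)
    (J : Measure ℝ) [IsProbabilityMeasure J]
    (hJ0 : J (Set.Iic 0) = 0)
    (hJmean : ∫ z, z ∂J = 1)
    (hJdens : DensityLowerBdd J)
    (f₁ f₂ : ℝ → ℝ → ℝ)
    (h₁ : IsMFM η J f₁) (h₂ : IsMFM η J f₂)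
    (h0 : ∀ x : ℝ, f₁ x 0 = f₂ x 0) :
    ∀ x t : ℝ, 0 ≤ t → f₁ x t = f₂ x t := by
  have hη : AEStronglyMeasurable η (volume.restrict (Ioo 0 1)) :=
    (hη_cont.mono Ioo_subset_Icc_self).aestronglyMeasurable measurableSet_Ioo
  have hb : ∀ ν ∈ Ioo (0 : ℝ) 1, |η ν| ≤ 1 := fun ν hν => by
    have hν' := Ioo_subset_Icc_self hν
    have h1 := hη_anti.antitoneOn (by simp) hν' hν.1.le
    have h2 := hη_anti.antitoneOn hν' (by simp) hν.2.le
    rw [abs_le]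
    constructor <;> linarith
  have hn : ∀ n : ℕ, ∀ x t, 0 ≤ t → |f₁ x t - f₂ x t| ≤ (1 / 2) ^ n * Real.exp (4 * t) := by
    intro n
    induction n with
    | zero =>
      intro x t ht
      have hx := (h₁.1 t ht).mem_Icc x
      have hy := (h₂.1 t ht).mem_Icc x
      have he : 1 ≤ Real.exp (4 * t) := Real.one_le_exp (by positivity)
      rw [pow_zero, one_mul, abs_le]
      constructor <;> linarith [hx.1, hx.2, hy.1, hy.2]
    | succ n ih =>
      intro x t ht
      have := h₁.abs_sub_le_half hη hb hJ0 h₂ h0 (by positivity) ih x t ht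
      rwa [pow_succ, mul_one_div]
  intro x t ht
  have hlim : Tendsto (fun n : ℕ => (1 / 2 : ℝ) ^ n * Real.exp (4 * t)) atTop (nhds 0) := by
    simpa using (tendsto_pow_atTop_nhds_zero_of_lt_one (by norm_num : (0 : ℝ) ≤ 1 / 2)
      (by norm_num)).mul_const (Real.exp (4 * t))
  have hle := ge_of_tendsto' hlim fun n => hn n x t ht
  exact sub_eq_zero.1 (abs_nonpos_iff.1 hle)

end Theorems
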